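/- Two finite graphs G and H are practionally isomorphic if and only if for every connected graph Γ, (1/v(G))·Σ_{i : G[A_i] practionally isomorphic to Γ} |A_i| = (1/v(H))·Σ_{i : H[B_i] practionally isomorphic to Γ} |B_i|, where A_1,…,A_n and B_1,…,B_m are the vertex sets of the connected components of G and H respectively. -/

import Mathlib

open scoped BigOperators Classical

/-- `P` is an equitable partition of the finite graph `G` for the template `(D, p)`:
nonempty cells partitioning the vertex set, with `|P_j| = p_j·v(G)` and every vertex of
`P_j` having exactly `D j ℓ` neighbors in `P_ℓ`. -/
def IsEquitablePartition {V : Type} [Fintype V] (G : SimpleGraph V) {k : ℕ}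
    (P : Fin k → Finset V) (D : Fin k → Fin k → ℕ) (p : Fin k → ℝ) : Prop :=
  (∀ j, (P j).Nonempty) ∧ (∀ v : V, ∃! j, v ∈ P j) ∧
    (∀ j, ((P j).card : ℝ) = p j * (Fintype.card V)) ∧
    (∀ j ℓ, ∀ v ∈ P j, ((P ℓ).filter (fun w => G.Adj v w)).card = D j ℓ)

/-- Two finite graphs are practionally isomorphic if they admit equitable partitions
with a common template `(D, p)` (with `p` positive). -/
def PractionallyIso {V W : Type} [Fintype V] [Fintype W]
    (G : SimpleGraph V) (H : SimpleGraph W) : Prop :=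
  ∃ (k : ℕ) (D : Fin k → Fin k → ℕ) (p : Fin k → ℝ),
    (∀ j, 0 < p j) ∧
    (∃ P : Fin k → Finset V, IsEquitablePartition G P D p) ∧
    (∃ Q : Fin k → Finset W, IsEquitablePartition H Q D p)

section ColorRefinement

variable {V W : Type} [Fintype V] [Fintype W]

/-- The colour of a vertex after `n` rounds of colour refinement, encoded as a natural number so
that colours in different graphs can be compared. -/
noncomputable def refineColor (G : SimpleGraph V) : ℕ → V → ℕ
  | 0, _ => 0
  | n + 1, v => Encodable.encode
      (refineColor G n v, (Finset.univ.filter (G.Adj v)).val.map (refineColor G n))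

/-- The stable colour of a vertex: the sequence of its colours under colour refinement. -/
noncomputable def stableColor (G : SimpleGraph V) (v : V) : ℕ → ℕ := fun n => refineColor G n v

/-- The number of vertices with a given stable colour. -/
noncomputable def classCard (G : SimpleGraph V) (x : ℕ → ℕ) : ℕ :=
  (Finset.univ.filter (fun v => stableColor G v = x)).card

/-- The number of neighbours of `v` with a given stable colour. -/
noncomputable def nbrCard (G : SimpleGraph V) (v : V) (x : ℕ → ℕ) : ℕ :=
  (Finset.univ.filter (fun w => G.Adj v w ∧ stableColor G w = x)).card

theorem refineColor_succ_eq_iff {G : SimpleGraph V} {H : SimpleGraph W} {n : ℕ} {v : V} {w : W} :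
    refineColor G (n + 1) v = refineColor H (n + 1) w ↔
      refineColor G n v = refineColor H n w ∧
        (Finset.univ.filter (G.Adj v)).val.map (refineColor G n) =
          (Finset.univ.filter (H.Adj w)).val.map (refineColor H n) := by
  simp only [refineColor, Encodable.encode_inj, Prod.mk.injEq]

theorem refineColor_eq_of_le {G : SimpleGraph V} {H : SimpleGraph W} {m n : ℕ} (hmn : m ≤ n)
    {v : V} {w : W} (h : refineColor G n v = refineColor H n w) :
    refineColor G m v = refineColor H m w := by
  induction hmn with
  | refl => exact h
  | step _ ih => exact ih (refineColor_succ_eq_iff.1 h).1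

theorem exists_refineColor_determines (G : SimpleGraph V) (H : SimpleGraph W) :
    ∃ N, ∀ v w, refineColor G N v = refineColor H N w → stableColor G v = stableColor H w := by
  have h : ∀ q : V × W, ∃ N, refineColor G N q.1 = refineColor H N q.2 →
      stableColor G q.1 = stableColor H q.2 := by
    rintro ⟨v, w⟩
    by_cases hvw : stableColor G v = stableColor H w
    · exact ⟨0, fun _ => hvw⟩
    · obtain ⟨n, hn⟩ := Function.ne_iff.1 hvw
      exact ⟨n, fun h => (hn h).elim⟩
  choose N hN using h
  refine ⟨Finset.univ.sup N, fun v w hvw => hN (v, w) ?_⟩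
  exact refineColor_eq_of_le (Finset.le_sup (Finset.mem_univ (v, w))) hvw

theorem nbrCard_eq_count {G : SimpleGraph V} {N : ℕ} {x : ℕ → ℕ} (v : V)
    (hN : ∀ u, refineColor G N u = x N ↔ stableColor G u = x) :
    nbrCard G v x =
      ((Finset.univ.filter (G.Adj v)).val.map (refineColor G N)).count (x N) := by
  rw [Multiset.count_map, nbrCard, ← Finset.filter_filter, Finset.card_def, Finset.filter_val]
  congr 1
  refine Multiset.filter_congr fun u _ => ?_
  rw [← hN u, eq_comm]

/-- The stable colouring is equitable, simultaneously in all graphs. -/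
theorem nbrCard_eq_of_stableColor_eq {G : SimpleGraph V} {H : SimpleGraph W} {v : V} {w : W}
    (h : stableColor G v = stableColor H w) (x : ℕ → ℕ) : nbrCard G v x = nbrCard H w x := by
  obtain ⟨N₁, h₁⟩ := exists_refineColor_determines G G
  obtain ⟨N₂, h₂⟩ := exists_refineColor_determines G H
  obtain ⟨N₃, h₃⟩ := exists_refineColor_determines H H
  obtain ⟨N, hN₁, hN₂, hN₃⟩ : ∃ N, N₁ ≤ N ∧ N₂ ≤ N ∧ N₃ ≤ N :=
    ⟨max N₁ (max N₂ N₃), by omega, by omega, by omega⟩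
  by_cases hx : (∃ u, stableColor G u = x) ∨ (∃ u, stableColor H u = x)
  · have hG : ∀ u, refineColor G N u = x N ↔ stableColor G u = x := by
      intro u
      refine ⟨fun hu => ?_, fun hu => congrFun hu N⟩
      rcases hx with ⟨u', rfl⟩ | ⟨u', rfl⟩
      · exact h₁ _ _ (refineColor_eq_of_le hN₁ hu)
      · exact h₂ _ _ (refineColor_eq_of_le hN₂ hu)
    have hH : ∀ u, refineColor H N u = x N ↔ stableColor H u = x := by
      intro u
      refine ⟨fun hu => ?_, fun hu => congrFun hu N⟩
      rcases hx with ⟨u', rfl⟩ | ⟨u', rfl⟩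
      · exact (h₂ _ _ (refineColor_eq_of_le hN₂ hu.symm)).symm
      · exact h₃ _ _ (refineColor_eq_of_le hN₃ hu)
    rw [nbrCard_eq_count v hG, nbrCard_eq_count w hH,
      (refineColor_succ_eq_iff.1 (congrFun h (N + 1))).2]
  · push Not at hx
    simp [nbrCard, hx.1, hx.2]

theorem exists_adj_of_stableColor_eq {G : SimpleGraph V} {H : SimpleGraph W} {v u : V} {w : W}
    (h : stableColor G v = stableColor H w) (hvu : G.Adj v u) :
    ∃ t, H.Adj w t ∧ stableColor G u = stableColor H t := by
  have h₁ : 0 < nbrCard G v (stableColor G u) := Finset.card_pos.2 ⟨u, by simp [hvu]⟩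
  rw [nbrCard_eq_of_stableColor_eq h] at h₁
  obtain ⟨t, ht⟩ := Finset.card_pos.1 h₁
  simp only [Finset.mem_filter, Finset.mem_univ, true_and] at ht
  exact ⟨t, ht.1, ht.2.symm⟩

theorem classCard_pos {G : SimpleGraph V} {x : ℕ → ℕ} :
    0 < classCard G x ↔ x ∈ Set.range (stableColor G) := by
  simp [classCard, Finset.card_pos, Finset.Nonempty]

/-- Stable colours are invariant under maps that are bijective on neighbourhoods. -/
theorem stableColor_map {G : SimpleGraph V} {H : SimpleGraph W} (f : V ↪ W)
    (hf : ∀ v, Finset.univ.filter (H.Adj (f v)) = (Finset.univ.filter (G.Adj v)).map f) (v : V) :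
    stableColor H (f v) = stableColor G v := by
  funext n
  change refineColor H n (f v) = refineColor G n v
  induction n generalizing v with
  | zero => rfl
  | succ n ih =>
    refine refineColor_succ_eq_iff.2 ⟨ih v, ?_⟩
    rw [hf, Finset.map_val, Multiset.map_map]
    exact Multiset.map_congr rfl fun u _ => ih u

theorem stableColor_iso {G : SimpleGraph V} {H : SimpleGraph W} (e : G ≃g H) (v : V) :
    stableColor H (e v) = stableColor G v := by
  refine stableColor_map e.toEquiv.toEmbedding (fun v => ?_) v
  ext w
  obtain ⟨w, rfl⟩ := e.surjective w
  rw [Finset.mem_map_equiv, Finset.mem_filter_univ, Finset.mem_filter_univ]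
  erw [e.toEquiv.symm_apply_apply]
  exact e.map_adj_iff

theorem stableColor_induce_supp (G : SimpleGraph V) (C : G.ConnectedComponent) [Fintype C.supp]
    (v : C.supp) : stableColor (G.induce C.supp) v = stableColor G v := by
  refine (stableColor_map (Function.Embedding.subtype _) (fun v => ?_) v).symm
  ext w
  rw [Finset.mem_filter_univ, Finset.mem_map]
  constructor
  · intro h
    exact ⟨⟨w, C.mem_supp_of_adj_mem_supp v.2 h⟩, (Finset.mem_filter_univ _).2 h, rfl⟩
  · rintro ⟨u, hu, rfl⟩
    rw [Finset.mem_filter_univ] at hu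
    exact hu

theorem refineColor_eq_of_isEquitablePartition {G : SimpleGraph V} {H : SimpleGraph W} {k : ℕ}
    {P : Fin k → Finset V} {Q : Fin k → Finset W} {D : Fin k → Fin k → ℕ} {p q : Fin k → ℝ}
    (hP : IsEquitablePartition G P D p) (hQ : IsEquitablePartition H Q D q) (n : ℕ) :
    ∀ {j v w}, v ∈ P j → w ∈ Q j → refineColor G n v = refineColor H n w := by
  obtain ⟨hPne, hPpart, -, hPD⟩ := hP
  obtain ⟨hQne, hQpart, -, hQD⟩ := hQ
  induction n with
  | zero => intros; rfl
  | succ n ih =>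
    intro j v w hv hw
    refine refineColor_succ_eq_iff.2 ⟨ih hv hw, ?_⟩
    choose a ha using hPne
    choose b hb using hQne
    choose g hg hg' using hPpart
    choose g' hg₁ hg₁' using hQpart
    obtain ⟨φ, hG, hH⟩ : ∃ φ : Fin k → ℕ, refineColor G n = φ ∘ g ∧ refineColor H n = φ ∘ g' :=
      ⟨fun ℓ => refineColor G n (a ℓ),
        funext fun u => (ih (hg u) (hb _)).trans (ih (ha _) (hb _)).symm,
        funext fun u => (ih (ha _) (hg₁ u)).symm⟩
    rw [hH, hG, ← Multiset.map_map, ← Multiset.map_map]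
    refine congrArg (Multiset.map _) ((Multiset.ext (α := Fin k)).2 fun ℓ => ?_)
    have h₁ := hPD j ℓ v hv
    have h₂ := hQD j ℓ w hw
    rw [Multiset.count_map, Multiset.count_map, ← Finset.filter_val, ← Finset.filter_val,
      ← Finset.card_def, ← Finset.card_def]
    rw [← h₂] at h₁
    convert h₁ using 2
    · ext u
      simp only [Finset.mem_filter, Finset.mem_univ, true_and]
      exact ⟨fun h => ⟨h.2 ▸ hg u, h.1⟩, fun h => ⟨h.2, hg' u _ h.1⟩⟩
    · ext u
      simp only [Finset.mem_filter, Finset.mem_univ, true_and]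
      exact ⟨fun h => ⟨h.2 ▸ hg₁ u, h.1⟩, fun h => ⟨h.2, hg₁' u _ h.1⟩⟩

theorem classCard_eq_of_isEquitablePartition {G : SimpleGraph V} {k : ℕ} {P : Fin k → Finset V}
    {D : Fin k → Fin k → ℕ} {p : Fin k → ℝ} (hP : IsEquitablePartition G P D p)
    {φ : Fin k → ℕ → ℕ} (hφ : ∀ j, ∀ v ∈ P j, stableColor G v = φ j) (x : ℕ → ℕ) :
    (classCard G x : ℝ) = (∑ j with φ j = x, p j) * Fintype.card V := by
  obtain ⟨-, hpart, hcard, -⟩ := hP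
  rw [Finset.sum_mul, ← Finset.sum_congr rfl fun j _ => hcard j, ← Nat.cast_sum,
    ← Finset.card_biUnion]
  · rw [classCard]
    congr 2
    ext v
    simp only [Finset.mem_filter, Finset.mem_univ, true_and, Finset.mem_biUnion]
    constructor
    · rintro rfl
      obtain ⟨j, hj, -⟩ := hpart v
      exact ⟨j, (hφ j v hj).symm, hj⟩
    · rintro ⟨j, rfl, hj⟩
      exact hφ j v hj
  · intro i _ j _ hij
    exact Finset.disjoint_left.2 fun v hi hj => hij ((hpart v).unique hi hj)

theorem classCard_mul_card_of_practionallyIso {G : SimpleGraph V} {H : SimpleGraph W}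
    (h : PractionallyIso G H) (x : ℕ → ℕ) :
    classCard G x * Fintype.card W = classCard H x * Fintype.card V := by
  obtain ⟨k, D, p, -, ⟨P, hP⟩, ⟨Q, hQ⟩⟩ := h
  have hc : ∀ {j v w}, v ∈ P j → w ∈ Q j → stableColor G v = stableColor H w :=
    fun hv hw => funext fun n => refineColor_eq_of_isEquitablePartition hP hQ n hv hw
  choose a ha using hP.1
  choose b hb using hQ.1
  have h₁ := classCard_eq_of_isEquitablePartition hP (φ := fun j => stableColor G (a j))
    (fun j v hv => (hc hv (hb j)).trans (hc (ha j) (hb j)).symm) x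
  have h₂ := classCard_eq_of_isEquitablePartition hQ (φ := fun j => stableColor G (a j))
    (fun j w hw => (hc (ha j) hw).symm) x
  have : (classCard G x * Fintype.card W : ℝ) = classCard H x * Fintype.card V := by
    rw [h₁, h₂]; ring
  exact_mod_cast this

theorem isEquitablePartition_stableColor [Nonempty V] (G : SimpleGraph V) {k : ℕ}
    {x : Fin k → ℕ → ℕ} (hinj : Function.Injective x)
    (hrange : Set.range x = Set.range (stableColor G)) {D : Fin k → Fin k → ℕ}
    (hD : ∀ v j, stableColor G v = x j → ∀ ℓ, nbrCard G v (x ℓ) = D j ℓ) :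
    IsEquitablePartition G (fun j => Finset.univ.filter fun v => stableColor G v = x j) D
      (fun j => (classCard G (x j) : ℝ) / Fintype.card V) := by
  refine ⟨fun j => ?_, fun v => ?_, fun j => ?_, fun j ℓ v hv => ?_⟩
  · obtain ⟨v, hv⟩ : x j ∈ Set.range (stableColor G) := hrange ▸ Set.mem_range_self j
    exact ⟨v, by simp [hv]⟩
  · obtain ⟨j, hj⟩ : stableColor G v ∈ Set.range x := hrange ▸ Set.mem_range_self v
    exact ⟨j, by simp [hj], fun i hi => hinj (by simp_all)⟩
  · rw [div_mul_cancel₀ _ (by exact_mod_cast Fintype.card_ne_zero)]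
    rfl
  · rw [← hD v j (by simpa using hv) ℓ, nbrCard, Finset.filter_filter]
    simp only [and_comm]

theorem practionallyIso_of_classCard [Nonempty V] [Nonempty W] {G : SimpleGraph V}
    {H : SimpleGraph W}
    (h : ∀ x, classCard G x * Fintype.card W = classCard H x * Fintype.card V) :
    PractionallyIso G H := by
  have hrange : Set.range (stableColor G) = Set.range (stableColor H) := by
    ext x
    rw [← classCard_pos, ← classCard_pos, ← Nat.mul_pos_iff_of_pos_right (Fintype.card_pos (α := W)),
      h x, Nat.mul_pos_iff_of_pos_right (Fintype.card_pos (α := V))]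
  obtain ⟨k, ⟨e⟩⟩ := Finite.exists_equiv_fin (Set.range (stableColor G))
  have hinj : Function.Injective fun j => (e.symm j : ℕ → ℕ) :=
    Subtype.val_injective.comp e.symm.injective
  have hx : (Set.range fun j => (e.symm j : ℕ → ℕ)) = Set.range (stableColor G) := by
    have := e.symm.surjective.range_comp (Subtype.val : Set.range (stableColor G) → ℕ → ℕ)
    rw [Subtype.range_coe] at this
    exact this
  choose a ha using fun j => (e.symm j).2
  refine ⟨k, fun j ℓ => nbrCard G (a j) (e.symm ℓ), _, fun j => ?_,
    ⟨_, isEquitablePartition_stableColor G hinj hx fun v j hv ℓ =>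
      nbrCard_eq_of_stableColor_eq (hv.trans (ha j).symm) _⟩, ?_⟩
  · have := classCard_pos.2 (e.symm j).2
    have := Fintype.card_pos (α := V)
    positivity
  · have := isEquitablePartition_stableColor H hinj (hx.trans hrange)
      (D := fun j ℓ => nbrCard G (a j) (e.symm ℓ)) fun v j hv ℓ =>
        nbrCard_eq_of_stableColor_eq (hv.trans (ha j).symm) _
    refine ⟨fun j => Finset.univ.filter fun v => stableColor H v = e.symm j, ?_⟩
    convert this using 2 with j
    rw [div_eq_div_iff (by exact_mod_cast Fintype.card_ne_zero)
      (by exact_mod_cast Fintype.card_ne_zero)]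
    exact_mod_cast h _

theorem practionallyIso_iff_classCard [Nonempty V] [Nonempty W] {G : SimpleGraph V}
    {H : SimpleGraph W} :
    PractionallyIso G H ↔
      ∀ x, classCard G x * Fintype.card W = classCard H x * Fintype.card V :=
  ⟨classCard_mul_card_of_practionallyIso, practionallyIso_of_classCard⟩

/-- Double counting of the edges between two colour classes. -/
theorem classCard_mul_nbrCard (G : SimpleGraph V) (H : SimpleGraph W) (a b : W) :
    classCard G (stableColor H a) * nbrCard H a (stableColor H b) =
      classCard G (stableColor H b) * nbrCard H b (stableColor H a) := by
  have h := Finset.sum_card_bipartiteAbove_eq_sum_card_bipartiteBelow G.Adj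
    (s := Finset.univ.filter fun v => stableColor G v = stableColor H a)
    (t := Finset.univ.filter fun v => stableColor G v = stableColor H b)
  have ha : ∀ v ∈ Finset.univ.filter (fun v => stableColor G v = stableColor H a),
      (Finset.bipartiteAbove G.Adj
        (Finset.univ.filter fun v => stableColor G v = stableColor H b) v).card =
        nbrCard H a (stableColor H b) := by
    intro v hv
    rw [← nbrCard_eq_of_stableColor_eq (by simpa using hv), nbrCard, Finset.bipartiteAbove,
      Finset.filter_filter]
    simp only [and_comm]
  have hb : ∀ v ∈ Finset.univ.filter (fun v => stableColor G v = stableColor H b),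
      (Finset.bipartiteBelow G.Adj
        (Finset.univ.filter fun v => stableColor G v = stableColor H a) v).card =
        nbrCard H b (stableColor H a) := by
    intro v hv
    rw [← nbrCard_eq_of_stableColor_eq (by simpa using hv), nbrCard, Finset.bipartiteBelow,
      Finset.filter_filter]
    simp only [and_comm, G.adj_comm]
  rw [Finset.sum_congr rfl ha, Finset.sum_congr rfl hb] at h
  simpa [classCard] using h

/-- The sizes of the colour classes of a connected graph are determined up to a common factor. -/
theorem classCard_mul_classCard (G : SimpleGraph V) {H : SimpleGraph W} (hH : H.Preconnected)
    (a b : W) :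
    classCard G (stableColor H a) * classCard H (stableColor H b) =
      classCard G (stableColor H b) * classCard H (stableColor H a) := by
  obtain ⟨walk⟩ := hH a b
  induction walk with
  | nil => rfl
  | @cons a c b hac _ ih =>
    have h₁ := classCard_mul_nbrCard G H a c
    have h₂ := classCard_mul_nbrCard H H a c
    have hp : 0 < nbrCard H a (stableColor H c) := Finset.card_pos.2 ⟨c, by simp [hac]⟩
    have hc : 0 < classCard H (stableColor H c) := classCard_pos.2 ⟨c, rfl⟩
    refine Nat.eq_of_mul_eq_mul_right (Nat.mul_pos hp hc) ?_
    calc _ = (classCard G (stableColor H a) * nbrCard H a (stableColor H c)) *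
          (classCard H (stableColor H c) * classCard H (stableColor H b)) := by ring
      _ = (classCard G (stableColor H c) * classCard H (stableColor H b)) *
          (classCard H (stableColor H c) * nbrCard H c (stableColor H a)) := by rw [h₁]; ring
      _ = _ := by rw [ih, ← h₂]; ring

/-- The number of vertices of `G` whose stable colour occurs in `H`. -/
noncomputable def sharedCard (G : SimpleGraph V) (H : SimpleGraph W) : ℕ :=
  (Finset.univ.filter fun v => stableColor G v ∈ Set.range (stableColor H)).card

theorem sharedCard_eq_sum (G : SimpleGraph V) (H : SimpleGraph W) :
    sharedCard G H = ∑ x ∈ Finset.univ.image (stableColor H), classCard G x := by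
  rw [sharedCard, Finset.card_eq_sum_card_fiberwise (f := stableColor G)
    (t := Finset.univ.image (stableColor H))]
  · refine Finset.sum_congr rfl fun x hx => ?_
    rw [classCard, Finset.filter_filter]
    congr 1
    refine Finset.filter_congr fun v _ => ⟨fun h => h.2, fun h => ⟨?_, h⟩⟩
    simpa [h] using hx
  · intro v hv
    simpa using hv

theorem sharedCard_self (H : SimpleGraph W) : sharedCard H H = Fintype.card W := by
  simp [sharedCard]

theorem classCard_mul_card_eq (G : SimpleGraph V) {H : SimpleGraph W} (hH : H.Preconnected)
    (a : W) :
    classCard G (stableColor H a) * Fintype.card W =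
      classCard H (stableColor H a) * sharedCard G H := by
  rw [← sharedCard_self H, sharedCard_eq_sum, sharedCard_eq_sum, Finset.mul_sum, Finset.mul_sum]
  refine Finset.sum_congr rfl fun x hx => ?_
  obtain ⟨b, -, rfl⟩ := Finset.mem_image.1 hx
  rw [classCard_mul_classCard G hH a b, mul_comm]

theorem range_stableColor_subset {G : SimpleGraph V} {H : SimpleGraph W} (hG : G.Preconnected)
    {v : V} (hv : stableColor G v ∈ Set.range (stableColor H)) :
    Set.range (stableColor G) ⊆ Set.range (stableColor H) := by
  rintro _ ⟨u, rfl⟩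
  obtain ⟨walk⟩ := hG v u
  induction walk with
  | nil => exact hv
  | cons hadj _ ih =>
    obtain ⟨w, hw⟩ := hv
    obtain ⟨t, -, ht⟩ := exists_adj_of_stableColor_eq hw.symm hadj
    exact ih ⟨t, ht.symm⟩

/-- Connected graphs are practionally isomorphic as soon as they share a stable colour. -/
theorem practionallyIso_iff_stableColor_mem_range {G : SimpleGraph V} {H : SimpleGraph W}
    (hG : G.Connected) (hH : H.Connected) (v : V) :
    PractionallyIso G H ↔ stableColor G v ∈ Set.range (stableColor H) := by
  have := hG.nonempty
  have := hH.nonempty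
  rw [practionallyIso_iff_classCard]
  constructor
  · intro h
    have hv : 0 < classCard G (stableColor G v) * Fintype.card W :=
      Nat.mul_pos (classCard_pos.2 ⟨v, rfl⟩) Fintype.card_pos
    rw [h] at hv
    exact classCard_pos.1 (Nat.pos_of_mul_pos_right hv)
  · intro hv x
    have hsub := range_stableColor_subset hG.preconnected hv
    have hshared : sharedCard G H = Fintype.card V := by
      rw [sharedCard, Finset.filter_true_of_mem fun u _ => hsub ⟨u, rfl⟩, Finset.card_univ]
    by_cases hx : x ∈ Set.range (stableColor H)
    · obtain ⟨a, rfl⟩ := hx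
      rw [classCard_mul_card_eq G hH.preconnected a, hshared]
    · rw [Nat.eq_zero_of_not_pos (mt classCard_pos.1 hx),
        Nat.eq_zero_of_not_pos (mt classCard_pos.1 fun h => hx (hsub h))]
      simp

theorem sum_practionallyIso_component (G : SimpleGraph V) {H : SimpleGraph W}
    (hH : H.Connected) :
    (∑ v : V, if PractionallyIso (SimpleGraph.induce ((G.connectedComponentMk v).supp) G) H
      then (1 : ℝ) else 0) = sharedCard G H := by
  rw [Finset.sum_boole, sharedCard]
  congr 2
  refine Finset.filter_congr fun v _ => ?_
  have hconn : (G.induce (G.connectedComponentMk v).supp).Connected :=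
    (G.connectedComponentMk v).connected_toSimpleGraph
  rw [practionallyIso_iff_stableColor_mem_range hconn hH ⟨v, rfl⟩]
  exact iff_of_eq (congrArg (· ∈ _)
    (stableColor_induce_supp G (G.connectedComponentMk v) ⟨v, rfl⟩))

theorem exists_connected_stableColor_mem_range (G : SimpleGraph V) (v : V) :
    ∃ (m : ℕ) (Γ : SimpleGraph (Fin m)), Γ.Connected ∧
      stableColor G v ∈ Set.range (stableColor Γ) := by
  let K := G.induce (G.connectedComponentMk v).supp
  have hK : K.Connected := (G.connectedComponentMk v).connected_toSimpleGraph
  let e := K.overFinIso rfl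
  refine ⟨_, _, e.connected_iff.1 hK, e ⟨v, rfl⟩, ?_⟩
  rw [stableColor_iso e, stableColor_induce_supp]

theorem classCard_mul_card_of_sharedCard {U : Type} [Fintype U] {G : SimpleGraph V}
    {H : SimpleGraph W} {Γ : SimpleGraph U} (hΓ : Γ.Connected)
    (h : sharedCard G Γ * Fintype.card W = sharedCard H Γ * Fintype.card V) {x : ℕ → ℕ}
    (hx : x ∈ Set.range (stableColor Γ)) :
    classCard G x * Fintype.card W = classCard H x * Fintype.card V := by
  have := hΓ.nonempty
  obtain ⟨a, rfl⟩ := hx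
  refine Nat.eq_of_mul_eq_mul_right (Fintype.card_pos (α := U)) ?_
  rw [mul_right_comm, classCard_mul_card_eq G hΓ.preconnected, mul_assoc, h, ← mul_assoc,
    ← classCard_mul_card_eq H hΓ.preconnected, mul_right_comm]

end ColorRefinement

/-- factorization of practional isomorphism.  `G` and `H` are practionally
isomorphic iff for every connected graph `Γ`, the proportion of vertices lying in
connected components whose induced graph is practionally isomorphic to `Γ` is the same
in `G` and in `H`. -/
theorem practionallyIso_iff_components
    {V V' : Type} [Fintype V] [Fintype V'] [Nonempty V] [Nonempty V']
    (G : SimpleGraph V) (H : SimpleGraph V') :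
    PractionallyIso G H ↔
      ∀ (m : ℕ) (Γ : SimpleGraph (Fin m)), Γ.Connected →
        (∑ v : V, if PractionallyIso
            (SimpleGraph.induce ((G.connectedComponentMk v).supp) G) Γ then (1 : ℝ) else 0)
            / (Fintype.card V) =
        (∑ v : V', if PractionallyIso
            (SimpleGraph.induce ((H.connectedComponentMk v).supp) H) Γ then (1 : ℝ) else 0)
            / (Fintype.card V') := by
  have hV : (Fintype.card V : ℝ) ≠ 0 := by exact_mod_cast Fintype.card_ne_zero
  have hV' : (Fintype.card V' : ℝ) ≠ 0 := by exact_mod_cast Fintype.card_ne_zero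
  rw [practionallyIso_iff_classCard]
  constructor
  · intro h m Γ hΓ
    rw [sum_practionallyIso_component G hΓ, sum_practionallyIso_component H hΓ,
      div_eq_div_iff hV hV']
    norm_cast
    rw [sharedCard_eq_sum, sharedCard_eq_sum, Finset.sum_mul, Finset.sum_mul]
    exact Finset.sum_congr rfl fun x _ => h x
  · intro h x
    have key : ∀ (m : ℕ) (Γ : SimpleGraph (Fin m)), Γ.Connected →
        x ∈ Set.range (stableColor Γ) →
        classCard G x * Fintype.card V' = classCard H x * Fintype.card V := by
      intro m Γ hΓ hx
      refine classCard_mul_card_of_sharedCard hΓ ?_ hx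
      have := h m Γ hΓ
      rw [sum_practionallyIso_component G hΓ, sum_practionallyIso_component H hΓ,
        div_eq_div_iff hV hV'] at this
      exact_mod_cast this
    by_cases hG : x ∈ Set.range (stableColor G)
    · obtain ⟨v, rfl⟩ := hG
      obtain ⟨m, Γ, hΓ, hx⟩ := exists_connected_stableColor_mem_range G v
      exact key m Γ hΓ hx
    by_cases hH : x ∈ Set.range (stableColor H)
    · obtain ⟨v, rfl⟩ := hH
      obtain ⟨m, Γ, hΓ, hx⟩ := exists_connected_stableColor_mem_range H v
      exact key m Γ hΓ hx
    rw [Nat.eq_zero_of_not_pos (mt classCard_pos.1 hG),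
      Nat.eq_zero_of_not_pos (mt classCard_pos.1 hH)]
    simp
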